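/- Let C be a cycle of goods and let three agents have nonnegative additive utility functions. Then there exists a partition of the vertices of C into three connected bundles such that each agent i receives a bundle of value at least (5/6)·mms^(3)(C,u_i). Moreover the constant 5/6 cannot be improved: there is a cycle with 9 goods and three agents for which no c-sufficient allocation exists for any c > 5/6. -/

import Mathlib

open scoped BigOperators

noncomputable section

/-- Total value of a bundle under an additive utility. -/
def bval {V : Type*} [DecidableEq V] (u : V → ℝ) (S : Finset V) : ℝ := ∑ v ∈ S, u v

/-- A `G`-bundle: a (possibly empty) set of vertices inducing a connected subgraph. -/
def IsBundle {V : Type*} (G : SimpleGraph V) (S : Finset V) : Prop :=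
  (S : Set V) = ∅ ∨ (G.induce (S : Set V)).Connected

/-- A split of the vertex set `A` into `n` pairwise disjoint `G`-bundles covering `A`. -/
def IsSplitOn {V : Type*} [DecidableEq V] (G : SimpleGraph V) (A : Finset V) (n : ℕ)
    (P : Fin n → Finset V) : Prop :=
  (∀ i, IsBundle G (P i)) ∧ (∀ i j, i ≠ j → Disjoint (P i) (P j)) ∧
  (∀ i, P i ⊆ A) ∧ (∀ v ∈ A, ∃ i, v ∈ P i)

/-- The maximin share over splits of `A` into `n` `G`-bundles. -/
def mmsOn {V : Type*} [DecidableEq V] (G : SimpleGraph V) (A : Finset V)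
    (n : ℕ) (u : V → ℝ) : ℝ :=
  sSup {q : ℝ | ∃ P : Fin n → Finset V, IsSplitOn G A n P ∧ ∀ i, q ≤ bval u (P i)}

/-- The maximin share `mms^(n)(G,u)`. -/
def mms {V : Type*} [DecidableEq V] [Fintype V] (G : SimpleGraph V)
    (n : ℕ) (u : V → ℝ) : ℝ := mmsOn G Finset.univ n u

/-- The cycle on `m` vertices, identified with `ZMod m`. -/
def cycleGraph (m : ℕ) : SimpleGraph (ZMod m) :=
  SimpleGraph.fromRel (fun v w => w = v + 1)

end

/-! ### The interleaved case: nine segments -/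

/-- Value of the segments `p, …, q-1`. -/
def segSum (x : ℕ → ℝ) (p q : ℕ) : ℝ := ∑ s ∈ Finset.Ico p q, x s

/-- No cyclic allocation in the order `x, y, z` gives everyone `5/6`. -/
def NoAlloc (x y z : ℕ → ℝ) : Prop :=
  ∀ p q r : ℕ, p ≤ q → q ≤ r → r ≤ p + 9 →
    5 / 6 ≤ segSum x p q → 5 / 6 ≤ segSum y q r → 5 / 6 ≤ segSum z r (p + 9) → False

/-- A hypothetical counterexample with nine interleaved cuts. -/
structure Cfg (x y z : ℕ → ℝ) : Prop where
  nx : ∀ s, 0 ≤ x s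
  ny : ∀ s, 0 ≤ y s
  nz : ∀ s, 0 ≤ z s
  px : ∀ s, x (s + 9) = x s
  py : ∀ s, y (s + 9) = y s
  pz : ∀ s, z (s + 9) = z s
  x0 : x 0 + x 1 + x 2 = 1
  x3 : x 3 + x 4 + x 5 = 1
  x6 : x 6 + x 7 + x 8 = 1
  y1 : y 1 + y 2 + y 3 = 1
  y4 : y 4 + y 5 + y 6 = 1
  y7 : y 7 + y 8 + y 0 = 1
  z2 : z 2 + z 3 + z 4 = 1
  z5 : z 5 + z 6 + z 7 = 1
  z8 : z 8 + z 0 + z 1 = 1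
  n1 : NoAlloc x y z
  n2 : NoAlloc x z y

lemma segSum_shift (x : ℕ → ℝ) (p q : ℕ) :
    segSum (fun s => x (s + 1)) p q = segSum x (p + 1) (q + 1) := by
  unfold segSum
  rw [Finset.sum_Ico_add' (fun s => x s) p q 1]

lemma segSum_periodic {x : ℕ → ℝ} (h : ∀ s, x (s + 9) = x s) (p q : ℕ) :
    segSum x (p + 9) (q + 9) = segSum x p q := by
  unfold segSum
  rw [← Finset.sum_Ico_add' (fun s => x s) p q 9]
  exact Finset.sum_congr rfl fun s _ => h s

lemma NoAlloc.rot {x y z : ℕ → ℝ} (hy : ∀ s, y (s + 9) = y s)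
    (hz : ∀ s, z (s + 9) = z s) (h : NoAlloc x y z) : NoAlloc y z x := by
  intro p q r hpq hqr hr h1 h2 h3
  refine h r (p + 9) (q + 9) hr (by omega) (by omega) h3 ?_ ?_
  · rwa [segSum_periodic hy]
  · rwa [segSum_periodic hz]

lemma NoAlloc.shift {x y z : ℕ → ℝ} (h : NoAlloc x y z) :
    NoAlloc (fun s => x (s + 1)) (fun s => y (s + 1)) (fun s => z (s + 1)) := by
  intro p q r hpq hqr hr h1 h2 h3
  rw [segSum_shift] at h1 h2 h3
  exact h (p + 1) (q + 1) (r + 1) (by omega) (by omega) (by omega) h1 h2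
    (by rwa [show p + 1 + 9 = p + 9 + 1 by ring])

lemma Cfg.rot {x y z : ℕ → ℝ} (h : Cfg x y z) :
    Cfg (fun s => y (s + 1)) (fun s => z (s + 1)) (fun s => x (s + 1)) where
  nx s := h.ny _
  ny s := h.nz _
  nz s := h.nx _
  px s := h.py (s + 1)
  py s := h.pz (s + 1)
  pz s := h.px (s + 1)
  x0 := h.y1
  x3 := h.y4
  x6 := by have := h.y7; have := h.py 0; norm_num at *; linarith
  y1 := h.z2
  y4 := h.z5
  y7 := by have := h.z8; have := h.pz 0; norm_num at *; linarith
  z2 := h.x3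
  z5 := h.x6
  z8 := by
    have := h.x0; have := h.px 0; have := h.px 1; have := h.px 2
    norm_num at *; linarith
  n1 := (h.n1.rot h.py h.pz).shift
  n2 := ((h.n2.rot h.pz h.py).rot h.py h.px).shift

lemma Cfg.key {x y z : ℕ → ℝ} (h : Cfg x y z)
    (hy3 : y 3 + y 4 + y 5 < 5 / 6) (hy6 : y 6 + y 7 + y 8 < 5 / 6)
    (hz3 : z 3 + z 4 + z 5 < 5 / 6) (hz6 : z 6 + z 7 + z 8 < 5 / 6) :
    1 / 2 < y 0 ∧ 1 / 2 < y 2 ∧ 1 / 2 < z 0 ∧ 1 / 2 < z 2 := by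
  obtain ⟨nx, ny, nz, px, py, pz, x0, x3, x6, y1, y4, y7, z2, z5, z8, n1, n2⟩ := h
  have py0 : y 9 = y 0 := py 0; have py1 := py 1; have py2 := py 2; have py3 := py 3
  have py4 := py 4; have py5 := py 5
  have pz0 : z 9 = z 0 := pz 0; have pz1 := pz 1; have pz2 := pz 2; have pz3 := pz 3
  have pz4 := pz 4; have pz5 := pz 5
  have a1 := n1 6 9 11 (by norm_num) (by norm_num) (by norm_num)
  have a2 := n1 3 6 10 (by norm_num) (by norm_num) (by norm_num)
  have a5 := n2 3 6 10 (by norm_num) (by norm_num) (by norm_num)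
  have a6 := n2 6 9 11 (by norm_num) (by norm_num) (by norm_num)
  simp only [segSum, Finset.sum_Ico_eq_sum_range] at a1 a2 a5 a6
  norm_num [Finset.sum_range_succ] at a1 a2 a5 a6 py1 py2 py3 py4 py5 pz1 pz2 pz3 pz4 pz5
  have b1 : y 0 + y 1 < 5 / 6 := by
    by_contra hc
    exact (a1 (by linarith) (by linarith)).not_ge (by linarith [nz 5])
  have b2 : z 1 + z 2 < 5 / 6 := by
    by_contra hc
    exact (a2 (by linarith) (by linarith [ny 6])).not_ge (by linarith)
  have b3 : z 2 < 5 / 6 := by linarith [nz 1]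
  have b4 : y 0 < 5 / 6 := by linarith [ny 1]
  have b5 : y 1 + y 2 < 5 / 6 := by
    by_contra hc
    have : z 6 + z 7 + z 8 + z 0 < 5 / 6 := by
      by_contra hd
      exact (a5 (by linarith) (by linarith)).not_ge (by linarith)
    linarith [nz 0, nz 1, nz 2, nz 3, nz 4, nz 5, nz 6, nz 7, nz 8]
  have b6 : z 0 + z 1 < 5 / 6 := by
    by_contra hc
    have : y 2 + y 3 + y 4 + y 5 < 5 / 6 := by
      by_contra hd
      exact (a6 (by linarith) (by linarith)).not_ge (by linarith)
    linarith [ny 0, ny 1, ny 2, ny 3, ny 4, ny 5, ny 6, ny 7, ny 8]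
  refine ⟨?_, ?_, ?_, ?_⟩ <;> linarith

lemma Cfg.rot3 {x y z : ℕ → ℝ} (h : Cfg x y z) :
    Cfg (fun s => x (s + 3)) (fun s => y (s + 3)) (fun s => z (s + 3)) :=
  h.rot.rot.rot

lemma Cfg.exists_part {x y z : ℕ → ℝ} (h : Cfg x y z) :
    (1 / 2 < y 0 ∧ 1 / 2 < y 2 ∧ 1 / 2 < z 0 ∧ 1 / 2 < z 2) ∨
    (1 / 2 < y 3 ∧ 1 / 2 < y 5 ∧ 1 / 2 < z 3 ∧ 1 / 2 < z 5) ∨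
    (1 / 2 < y 6 ∧ 1 / 2 < y 8 ∧ 1 / 2 < z 6 ∧ 1 / 2 < z 8) := by
  have k0 := h.key
  have k3 := h.rot3.key
  have k6 := h.rot3.rot3.key
  obtain ⟨nx, ny, nz, px, py, pz, x0, x3, x6, y1, y4, y7, z2, z5, z8, n1, n2⟩ := h
  have py0 : y 9 = y 0 := py 0
  have py1 : y 10 = y 1 := py 1
  have py2 : y 11 = y 2 := py 2
  have py3 : y 12 = y 3 := py 3
  have py4 : y 13 = y 4 := py 4
  have py5 : y 14 = y 5 := py 5
  have pz0 : z 9 = z 0 := pz 0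
  have pz1 : z 10 = z 1 := pz 1
  have pz2 : z 11 = z 2 := pz 2
  have pz3 : z 12 = z 3 := pz 3
  have pz4 : z 13 = z 4 := pz 4
  have pz5 : z 14 = z 5 := pz 5
  have a0 := n1 0 3 6 (by norm_num) (by norm_num) (by norm_num)
  have a1 := n1 3 6 9 (by norm_num) (by norm_num) (by norm_num)
  have a2 := n1 6 9 12 (by norm_num) (by norm_num) (by norm_num)
  have c0 := n2 0 3 6 (by norm_num) (by norm_num) (by norm_num)
  have c1 := n2 3 6 9 (by norm_num) (by norm_num) (by norm_num)
  have c2 := n2 6 9 12 (by norm_num) (by norm_num) (by norm_num)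
  simp only [segSum, Finset.sum_Ico_eq_sum_range] at a0 a1 a2 c0 c1 c2
  norm_num [Finset.sum_range_succ] at a0 a1 a2 c0 c1 c2 k0 k3 k6
  simp only [py0, py1, py2, py3, py4, py5, pz0, pz1, pz2, pz3, pz4, pz5] at a0 a1 a2 c0 c1 c2 k0 k3 k6
  replace a0 := a0 (by linarith)
  replace a1 := a1 (by linarith)
  replace a2 := a2 (by linarith)
  replace c0 := c0 (by linarith)
  replace c1 := c1 (by linarith)
  replace c2 := c2 (by linarith)
  have ey : ¬ (y 0 + y 1 + y 2 < 5 / 6 ∧ y 3 + y 4 + y 5 < 5 / 6 ∧ y 6 + y 7 + y 8 < 5 / 6) := by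
    rintro ⟨h1, h2, h3⟩; linarith
  have ez : ¬ (z 0 + z 1 + z 2 < 5 / 6 ∧ z 3 + z 4 + z 5 < 5 / 6 ∧ z 6 + z 7 + z 8 < 5 / 6) := by
    rintro ⟨h1, h2, h3⟩; linarith
  simp only [← not_lt] at a0 a1 a2 c0 c1 c2
  clear x0 x3 x6 y1 y4 y7 z2 z5 z8 n1 n2 py0 py1 py2 py3 py4 py5 pz0 pz1 pz2 pz3 pz4 pz5
  clear nx ny nz px py pz
  generalize (y 0 + y 1 + y 2 < 5 / 6) = Y0 at *
  generalize (y 3 + y 4 + y 5 < 5 / 6) = Y3 at *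
  generalize (y 6 + y 7 + y 8 < 5 / 6) = Y6 at *
  generalize (z 0 + z 1 + z 2 < 5 / 6) = Z0 at *
  generalize (z 3 + z 4 + z 5 < 5 / 6) = Z3 at *
  generalize (z 6 + z 7 + z 8 < 5 / 6) = Z6 at *
  by_cases hy0 : Y0 <;> by_cases hy3 : Y3 <;> by_cases hy6 : Y6 <;>
    simp only [hy0, hy3, hy6, true_and, and_true, not_true, not_false_iff, and_false, false_and,
      true_implies, false_implies, imp_false] at a0 a1 a2 c0 c1 c2 ey ez k0 k3 k6 <;>
    tauto

lemma Cfg.elim {x y z : ℕ → ℝ} (h : Cfg x y z) : False := by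
  have k0 := h.exists_part
  have k1 := h.rot.exists_part
  have k2 := h.rot.rot.exists_part
  obtain ⟨nx, ny, nz, px, py, pz, x0, x3, x6, y1, y4, y7, z2, z5, z8, n1, n2⟩ := h
  have px0 : x 9 = x 0 := px 0
  have px1 : x 10 = x 1 := px 1
  have py1 : y 10 = y 1 := py 1
  have pz0 : z 9 = z 0 := pz 0
  norm_num at k0 k1 k2
  simp only [px0, px1, py1, pz0] at k0 k1 k2
  rcases k0 with ⟨_, _, _, _⟩ | ⟨_, _, _, _⟩ | ⟨_, _, _, _⟩ <;>
  rcases k1 with ⟨_, _, _, _⟩ | ⟨_, _, _, _⟩ | ⟨_, _, _, _⟩ <;>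
  rcases k2 with ⟨_, _, _, _⟩ | ⟨_, _, _, _⟩ | ⟨_, _, _, _⟩ <;>
  linarith [nx 0, nx 1, nx 2, nx 3, nx 4, nx 5, nx 6, nx 7, nx 8,
    ny 0, ny 1, ny 2, ny 3, ny 4, ny 5, ny 6, ny 7, ny 8,
    nz 0, nz 1, nz 2, nz 3, nz 4, nz 5, nz 6, nz 7, nz 8]

/-! ### The problem on the line -/

/-- There is a cyclic allocation giving each agent `5/6` of `μ`. -/
def LineOk (m : ℕ) (F : Fin 3 → ℕ → ℝ) (μ : Fin 3 → ℝ) : Prop :=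
  ∃ i j k : Fin 3, i ≠ j ∧ j ≠ k ∧ i ≠ k ∧ ∃ p q r : ℕ, p ≤ q ∧ q ≤ r ∧ r ≤ p + m ∧
    5 / 6 * μ i ≤ F i q - F i p ∧ 5 / 6 * μ j ≤ F j r - F j q ∧
    5 / 6 * μ k ≤ F k (p + m) - F k r

lemma lineOk_of_contained {m : ℕ} {F : Fin 3 → ℕ → ℝ} {μ : Fin 3 → ℝ} (hF : ∀ i, Monotone (F i))
    {T : Fin 3 → ℝ} (hT : ∀ i n, F i (n + m) = F i n + T i) (hμ : ∀ i, 0 ≤ μ i)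
    (h3 : ∀ i, 3 * μ i ≤ T i)
    {i j l : Fin 3} (hij : i ≠ j) (hjl : j ≠ l) (hil : i ≠ l)
    {p q b0 b1 b2 : ℕ} (h0p : b0 ≤ p) (hpq : p ≤ q) (hq1 : q ≤ b1) (h12 : b1 ≤ b2)
    (h23 : b2 ≤ b0 + m) (hA : μ i ≤ F i q - F i p) (hA' : 2 * μ i ≤ F i (p + m) - F i q)
    (hb1 : μ j ≤ F j b2 - F j b1) (hb2 : μ j ≤ F j (b0 + m) - F j b2) : LineOk m F μ := by
  have e1 : μ j ≤ F j b2 - F j q := by linarith [hF j hq1]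
  have e2 : μ j ≤ F j (p + m) - F j b2 := by
    linarith [hF j (show b0 + m ≤ p + m by omega)]
  have hqr : q ≤ b2 := hq1.trans h12
  have hr : b2 ≤ p + m := by omega
  have := hμ i
  have := hμ j
  have := hμ l
  by_cases hl : F l q - F l p ≤ 4 / 3 * μ l
  · by_cases hl2 : 5 / 6 * μ l ≤ F l b2 - F l q
    · exact ⟨i, l, j, hil, hjl.symm, hij, p, q, b2, hpq, hqr, hr, by linarith, hl2, by linarith⟩
    · refine ⟨i, j, l, hij, hjl, hil, p, q, b2, hpq, hqr, hr, by linarith, by linarith, ?_⟩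
      linarith [hT l p, h3 l]
  · by_cases hi2 : 5 / 6 * μ i ≤ F i b2 - F i q
    · exact ⟨l, i, j, hil.symm, hij, hjl.symm, p, q, b2, hpq, hqr, hr, by linarith, hi2, by linarith⟩
    · exact ⟨l, j, i, hjl.symm, hij.symm, hil.symm, p, q, b2, hpq, hqr, hr, by linarith,
        by linarith, by linarith⟩

lemma normalize_arc {a b c μ : ℝ} (ha : 0 ≤ a) (hb : 0 ≤ b) (hc : 0 ≤ c) (hμ : 0 ≤ μ)
    (h : μ ≤ a + b + c) : ∃ a' b' c' : ℝ, 0 ≤ a' ∧ 0 ≤ b' ∧ 0 ≤ c' ∧ a' + b' + c' = 1 ∧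
      μ * a' ≤ a ∧ μ * b' ≤ b ∧ μ * c' ≤ c := by
  rcases (add_nonneg (add_nonneg ha hb) hc).eq_or_lt with h0 | h0
  · refine ⟨1 / 3, 1 / 3, 1 / 3, by norm_num, by norm_num, by norm_num, by norm_num, ?_, ?_, ?_⟩ <;>
      nlinarith
  · have key : ∀ t : ℝ, 0 ≤ t → μ * (t / (a + b + c)) ≤ t := by
      intro t ht
      rw [mul_div_assoc', div_le_iff₀ h0]
      nlinarith
    exact ⟨a / (a + b + c), b / (a + b + c), c / (a + b + c), by positivity, by positivity,
      by positivity, by field_simp, key a ha, key b hb, key c hc⟩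

/-- Nine-periodic extension of nine reals. -/
def ext9 (a0 a1 a2 a3 a4 a5 a6 a7 a8 : ℝ) (n : ℕ) : ℝ :=
  match n % 9 with
  | 0 => a0 | 1 => a1 | 2 => a2 | 3 => a3 | 4 => a4 | 5 => a5 | 6 => a6 | 7 => a7 | _ => a8

lemma ext9_add (a0 a1 a2 a3 a4 a5 a6 a7 a8 : ℝ) (n : ℕ) :
    ext9 a0 a1 a2 a3 a4 a5 a6 a7 a8 (n + 9) = ext9 a0 a1 a2 a3 a4 a5 a6 a7 a8 n := by
  simp [ext9]

lemma forall_of_nine {P : ℕ → Prop} (hP : ∀ n, P n → P (n + 9)) (h0 : P 0) (h1 : P 1) (h2 : P 2)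
    (h3 : P 3) (h4 : P 4) (h5 : P 5) (h6 : P 6) (h7 : P 7) (h8 : P 8) : ∀ n, P n := by
  intro n
  induction n using Nat.strong_induction_on with
  | _ n ih =>
    by_cases hn : n < 9
    · interval_cases n <;> assumption
    · obtain ⟨k, rfl⟩ : ∃ k, n = k + 9 := ⟨n - 9, by omega⟩
      exact hP k (ih k (by omega))

/-- Normalised segment values of one agent. The shift `o` is where her own arcs begin. -/
lemma exists_segments {G : ℕ → ℝ} (hG : Monotone G) {d : ℕ → ℕ} (hd : Monotone d) {T : ℝ}
    (hT : ∀ n, G (d (n + 9)) = G (d n) + T) {μ : ℝ} (hμ : 0 ≤ μ) (o : ℕ)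
    (h0 : μ ≤ G (d (o + 3)) - G (d o)) (h3 : μ ≤ G (d (o + 6)) - G (d (o + 3)))
    (h6 : μ ≤ G (d (o + 9)) - G (d (o + 6))) :
    ∃ x : ℕ → ℝ, (∀ s, 0 ≤ x s) ∧ (∀ s, x (s + 9) = x s) ∧ x 0 + x 1 + x 2 = 1 ∧
      x 3 + x 4 + x 5 = 1 ∧ x 6 + x 7 + x 8 = 1 ∧
      ∀ s, μ * x s ≤ G (d (o + s + 1)) - G (d (o + s)) := by
  have hm : ∀ n, 0 ≤ G (d (n + 1)) - G (d n) := fun n =>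
    sub_nonneg.mpr (hG (hd (Nat.le_succ n)))
  obtain ⟨a0, a1, a2, p0, p1, p2, e0, l0, l1, l2⟩ := normalize_arc (hm o) (hm (o + 1)) (hm (o + 2)) hμ
    (by simp only [add_assoc] at h0 ⊢; norm_num at h0 ⊢; linarith)
  obtain ⟨a3, a4, a5, p3, p4, p5, e3, l3, l4, l5⟩ := normalize_arc (hm (o + 3)) (hm (o + 4))
    (hm (o + 5)) hμ (by simp only [add_assoc] at h3 ⊢; norm_num at h3 ⊢; linarith)
  obtain ⟨a6, a7, a8, p6, p7, p8, e6, l6, l7, l8⟩ := normalize_arc (hm (o + 6)) (hm (o + 7))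
    (hm (o + 8)) hμ (by simp only [add_assoc] at h6 ⊢; norm_num at h6 ⊢; linarith)
  refine ⟨ext9 a0 a1 a2 a3 a4 a5 a6 a7 a8, ?_, ext9_add _ _ _ _ _ _ _ _ _, e0, e3, e6, ?_⟩
  · exact forall_of_nine (fun n hn => by rwa [ext9_add]) p0 p1 p2 p3 p4 p5 p6 p7 p8
  · refine forall_of_nine (fun n hn => ?_) l0 l1 l2 l3 l4 l5 l6 l7 l8
    rw [ext9_add, show o + (n + 9) + 1 = o + n + 1 + 9 by ring, show o + (n + 9) = o + n + 9 by ring,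
      hT, hT]
    linarith

lemma mul_segSum_le {G : ℕ → ℝ} {d : ℕ → ℕ} {x : ℕ → ℝ} {μ : ℝ}
    (h : ∀ s, μ * x s ≤ G (d (s + 1)) - G (d s)) {p q : ℕ} (hpq : p ≤ q) :
    μ * segSum x p q ≤ G (d q) - G (d p) := by
  unfold segSum
  rw [Finset.mul_sum, ← Finset.sum_Ico_sub (fun s => G (d s)) hpq]
  exact Finset.sum_le_sum fun s _ => h s

lemma lineOk_of_interleaved {m : ℕ} {F : Fin 3 → ℕ → ℝ} {μ : Fin 3 → ℝ}
    (hF : ∀ i, Monotone (F i)) {T : Fin 3 → ℝ} (hT : ∀ i n, F i (n + m) = F i n + T i)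
    (hμ : ∀ i, 0 ≤ μ i) {i j k : Fin 3} (hij : i ≠ j) (hjk : j ≠ k) (hik : i ≠ k)
    {d : ℕ → ℕ} (hd : Monotone d) (hdm : ∀ n, d (n + 9) = d n + m)
    (hi : ∀ n, n = 0 ∨ n = 3 ∨ n = 6 → μ i ≤ F i (d (n + 3)) - F i (d n))
    (hj : ∀ n, n = 1 ∨ n = 4 ∨ n = 7 → μ j ≤ F j (d (n + 3)) - F j (d n))
    (hk : ∀ n, n = 2 ∨ n = 5 ∨ n = 8 → μ k ≤ F k (d (n + 3)) - F k (d n)) : LineOk m F μ := by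
  by_contra hno
  have hT' : ∀ l n, F l (d (n + 9)) = F l (d n) + T l := fun l n => by rw [hdm, hT]
  obtain ⟨x, nx, px, x0, x3, x6, lx⟩ := exists_segments (hF i) hd (hT' i) (hμ i) 0
    (hi 0 (by simp)) (hi 3 (by simp)) (hi 6 (by simp))
  obtain ⟨y, ny, py, y0, y3, y6, ly⟩ := exists_segments (hF j) hd (hT' j) (hμ j) 1
    (hj 1 (by simp)) (hj 4 (by simp)) (hj 7 (by simp))
  obtain ⟨z, nz, pz, z0, z3, z6, lz⟩ := exists_segments (hF k) hd (hT' k) (hμ k) 2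
    (hk 2 (by simp)) (hk 5 (by simp)) (hk 8 (by simp))
  have back : ∀ (l : Fin 3) (w w' : ℕ → ℝ) (o c : ℕ), o + c = 9 → (∀ s, w' s = w (s + c)) →
      (∀ s, μ l * w s ≤ F l (d (o + s + 1)) - F l (d (o + s))) →
      ∀ s, μ l * w' s ≤ F l (d (s + 1)) - F l (d s) := by
    intro l w w' o c hoc hw h s
    have := h (s + c)
    rw [hw]
    rw [show o + (s + c) + 1 = s + 1 + 9 by omega, show o + (s + c) = s + 9 by omega,
      hT', hT'] at this
    linarith
  have gx : ∀ s, μ i * x s ≤ F i (d (s + 1)) - F i (d s) := by simpa using lx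
  have gy := back j y (fun s => y (s + 8)) 1 8 rfl (fun _ => rfl) ly
  have gz := back k z (fun s => z (s + 7)) 2 7 rfl (fun _ => rfl) lz
  have huse : ∀ (l : Fin 3) (w : ℕ → ℝ), (∀ s, μ l * w s ≤ F l (d (s + 1)) - F l (d s)) →
      ∀ p q, p ≤ q → 5 / 6 ≤ segSum w p q → 5 / 6 * μ l ≤ F l (d q) - F l (d p) := by
    intro l w hw p q hpq hs
    have := mul_segSum_le (G := F l) hw hpq
    nlinarith [hμ l]
  have py' : ∀ s, y (s + 9) = y s := py
  have pz' : ∀ s, z (s + 9) = z s := pz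
  have cfg : Cfg x (fun s => y (s + 8)) (fun s => z (s + 7)) := by
    refine ⟨nx, fun s => ny _, fun s => nz _, px, fun s => py (s + 8), fun s => pz (s + 7),
      x0, x3, x6, ?_, ?_, ?_, ?_, ?_, ?_, ?_, ?_⟩
    · show y 9 + y 10 + y 11 = 1
      rw [py 0, py 1, py 2, y0]
    · show y 12 + y 13 + y 14 = 1
      rw [py 3, py 4, py 5, y3]
    · show y 15 + y 16 + y 8 = 1
      rw [py 6, py 7, y6]
    · show z 9 + z 10 + z 11 = 1
      rw [pz 0, pz 1, pz 2, z0]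
    · show z 12 + z 13 + z 14 = 1
      rw [pz 3, pz 4, pz 5, z3]
    · show z 15 + z 7 + z 8 = 1
      rw [pz 6, z6]
    · intro p q r hpq hqr hr h1 h2 h3
      refine hno ⟨i, j, k, hij, hjk, hik, d p, d q, d r, hd hpq, hd hqr, ?_, huse i _ gx _ _ hpq h1,
        huse j _ gy _ _ hqr h2, ?_⟩
      · rw [← hdm]; exact hd hr
      · rw [← hdm]; exact huse k _ gz _ _ hr h3
    · intro p q r hpq hqr hr h1 h2 h3
      refine hno ⟨i, k, j, hik, hjk.symm, hij, d p, d q, d r, hd hpq, hd hqr, ?_, huse i _ gx _ _ hpq h1,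
        huse k _ gz _ _ hqr h2, ?_⟩
      · rw [← hdm]; exact hd hr
      · rw [← hdm]; exact huse j _ gy _ _ hr h3
  exact cfg.elim

/-- Merge three interleaved sequences. -/
def merge3 (a b c : ℕ → ℕ) (n : ℕ) : ℕ :=
  match n % 3 with
  | 0 => a (n / 3) | 1 => b (n / 3) | _ => c (n / 3)

lemma merge3_zero (a b c : ℕ → ℕ) (t : ℕ) : merge3 a b c (3 * t) = a t := by
  have h1 : 3 * t % 3 = 0 := by omega
  have h2 : 3 * t / 3 = t := by omega
  simp only [merge3, h1, h2]

lemma merge3_one (a b c : ℕ → ℕ) (t : ℕ) : merge3 a b c (3 * t + 1) = b t := by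
  have h1 : (3 * t + 1) % 3 = 1 := by omega
  have h2 : (3 * t + 1) / 3 = t := by omega
  simp only [merge3, h1, h2]

lemma merge3_two (a b c : ℕ → ℕ) (t : ℕ) : merge3 a b c (3 * t + 2) = c t := by
  have h1 : (3 * t + 2) % 3 = 2 := by omega
  have h2 : (3 * t + 2) / 3 = t := by omega
  simp only [merge3, h1, h2]

lemma lineOk_of_sequences {m : ℕ} {F : Fin 3 → ℕ → ℝ} {μ : Fin 3 → ℝ}
    (hF : ∀ i, Monotone (F i)) {T : Fin 3 → ℝ} (hT : ∀ i n, F i (n + m) = F i n + T i)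
    (hμ : ∀ i, 0 ≤ μ i) {i j k : Fin 3} (hij : i ≠ j) (hjk : j ≠ k) (hik : i ≠ k)
    {a b c : ℕ → ℕ} (hab : ∀ n, a n ≤ b n) (hbc : ∀ n, b n ≤ c n) (hca : ∀ n, c n ≤ a (n + 1))
    (ha : ∀ n, a (n + 3) = a n + m) (hb : ∀ n, b (n + 3) = b n + m)
    (hc : ∀ n, c (n + 3) = c n + m)
    (hi : ∀ n, μ i ≤ F i (a (n + 1)) - F i (a n))
    (hj : ∀ n, μ j ≤ F j (b (n + 1)) - F j (b n))
    (hk : ∀ n, μ k ≤ F k (c (n + 1)) - F k (c n)) : LineOk m F μ := by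
  have cases3 : ∀ n : ℕ, ∃ t, n = 3 * t ∨ n = 3 * t + 1 ∨ n = 3 * t + 2 := fun n =>
    ⟨n / 3, by omega⟩
  refine lineOk_of_interleaved hF hT hμ hij hjk hik (d := merge3 a b c) ?_ ?_ ?_ ?_ ?_
  · refine monotone_nat_of_le_succ fun n => ?_
    obtain ⟨t, rfl | rfl | rfl⟩ := cases3 n
    · rw [merge3_zero, merge3_one]; exact hab t
    · rw [merge3_one, show 3 * t + 1 + 1 = 3 * t + 2 by ring, merge3_two]; exact hbc t
    · rw [merge3_two, show 3 * t + 2 + 1 = 3 * (t + 1) by ring, merge3_zero]; exact hca t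
  · intro n
    obtain ⟨t, rfl | rfl | rfl⟩ := cases3 n
    · rw [show 3 * t + 9 = 3 * (t + 3) by ring, merge3_zero, merge3_zero, ha]
    · rw [show 3 * t + 1 + 9 = 3 * (t + 3) + 1 by ring, merge3_one, merge3_one, hb]
    · rw [show 3 * t + 2 + 9 = 3 * (t + 3) + 2 by ring, merge3_two, merge3_two, hc]
  · rintro n (rfl | rfl | rfl)
    exacts [hi 0, hi 1, hi 2]
  · rintro n (rfl | rfl | rfl)
    exacts [hj 0, hj 1, hj 2]
  · rintro n (rfl | rfl | rfl)
    exacts [hk 0, hk 1, hk 2]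

theorem lineOk {m : ℕ} {F : Fin 3 → ℕ → ℝ} {μ : Fin 3 → ℝ}
    (hF : ∀ i, Monotone (F i)) {T : Fin 3 → ℝ} (hT : ∀ i n, F i (n + m) = F i n + T i)
    (hμ : ∀ i, 0 ≤ μ i) (e : Fin 3 → ℕ → ℕ) (he : ∀ i, Monotone (e i))
    (hem : ∀ i n, e i (n + 3) = e i n + m) (he0 : ∀ i, e i 0 < m)
    (hv : ∀ i n, μ i ≤ F i (e i (n + 1)) - F i (e i n)) : LineOk m F μ := by
  by_contra hno
  have h3 : ∀ i, 3 * μ i ≤ T i := by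
    intro i
    have h0 := hv i 0
    have h1 := hv i 1
    have h2 := hv i 2
    have h4 := hT i (e i 0)
    rw [← hem] at h4
    norm_num at h0 h1 h2 h4
    linarith
  have nc : ∀ i j : Fin 3, i ≠ j → ∀ n k, e j k ≤ e i n → e i (n + 1) ≤ e j (k + 1) → False := by
    intro i j hij n k h1 h2
    have third : ∀ i j : Fin 3, ∃ l : Fin 3, j ≠ l ∧ i ≠ l := by decide
    obtain ⟨l, hjl, hil⟩ := third i j
    refine hno (lineOk_of_contained hF hT hμ h3 hij hjl hil h1 (he i n.le_succ) h2
      (he j (k + 1).le_succ) ?_ (hv i n) ?_ (hv j (k + 1)) ?_)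
    · rw [← hem]; exact he j (k + 2).le_succ
    · rw [← hem]
      have := hv i (n + 1)
      have := hv i (n + 2)
      simp only [add_assoc] at *
      norm_num at *
      linarith
    · rw [← hem]; exact hv j (k + 2)
  have inter : ∀ i j : Fin 3, i ≠ j → ∃ k, ∀ n, e i (3 + n) ≤ e j (k + n) ∧
      e j (k + n) ≤ e i (3 + (n + 1)) := by
    intro i j hij
    have ex : ∃ k, e i 3 ≤ e j k := by
      refine ⟨6, ?_⟩
      have := hem i 0; have := hem j 0; have := hem j 3; have := he0 i
      norm_num at *
      omega
    have hk := Nat.find_spec ex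
    have hmin := fun k (h : k < Nat.find ex) => Nat.find_min ex h
    generalize Nat.find ex = k at hk hmin
    have hk0 : k ≠ 0 := by
      rintro rfl
      have := hem i 0; have := he0 j
      norm_num at *
      omega
    obtain ⟨k, rfl⟩ := Nat.exists_eq_succ_of_ne_zero hk0
    have hk' := hmin k (Nat.lt_succ_self k)
    refine ⟨k + 1, fun n => ?_⟩
    induction n with
    | zero =>
      refine ⟨hk, ?_⟩
      by_contra hlt
      exact nc i j hij 3 k (by omega) (by simpa using (not_le.mp hlt).le)
    | succ n ih =>
      obtain ⟨i1, i2⟩ := ih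
      have s1 : e i (3 + (n + 1)) ≤ e j (k + 1 + (n + 1)) := by
        by_contra hlt
        exact nc j i hij.symm (k + 1 + n) (3 + n) i1 (not_le.mp hlt).le
      refine ⟨s1, ?_⟩
      by_contra hlt
      exact nc i j hij (3 + (n + 1)) (k + 1 + n) i2 (not_le.mp hlt).le
  have fin : ∀ i j k : Fin 3, i ≠ j → j ≠ k → i ≠ k → ∀ s t,
      (∀ n, e i (3 + n) ≤ e j (s + n) ∧ e j (s + n) ≤ e i (3 + (n + 1))) →
      (∀ n, e i (3 + n) ≤ e k (t + n) ∧ e k (t + n) ≤ e i (3 + (n + 1))) →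
      e j s ≤ e k t → False := by
    intro i j k hij hjk hik s t hs ht hst
    have hbc : ∀ n, e j (s + n) ≤ e k (t + n) := by
      intro n
      induction n with
      | zero => exact hst
      | succ n ih =>
        by_contra hlt
        exact nc k j hjk.symm (t + n) (s + n) ih (not_le.mp hlt).le
    exact hno (lineOk_of_sequences hF hT hμ hij hjk hik (a := fun n => e i (3 + n))
      (b := fun n => e j (s + n)) (c := fun n => e k (t + n)) (fun n => (hs n).1) hbc
      (fun n => (ht n).2) (fun n => hem i (3 + n)) (fun n => hem j (s + n))
      (fun n => hem k (t + n)) (fun n => hv i (3 + n)) (fun n => hv j (s + n))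
      (fun n => hv k (t + n)))
  obtain ⟨s, hs⟩ := inter 0 1 (by decide)
  obtain ⟨t, ht⟩ := inter 0 2 (by decide)
  rcases le_total (e 1 s) (e 2 t) with h | h
  · exact fin 0 1 2 (by decide) (by decide) (by decide) s t hs ht h
  · exact fin 0 2 1 (by decide) (by decide) (by decide) t s ht hs h

/-! ### Arcs of the cycle -/

/-- The arc of the cycle with vertices `a, …, b-1`. -/
def arc (m a b : ℕ) : Finset (ZMod m) := (Finset.Ico a b).image (fun n : ℕ => (n : ZMod m))

lemma mem_arc {m a b : ℕ} {v : ZMod m} : v ∈ arc m a b ↔ ∃ n, a ≤ n ∧ n < b ∧ (n : ZMod m) = v := by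
  simp [arc, and_assoc]

lemma cast_inj_window {m a n n' : ℕ} (h : (n : ZMod m) = n') (h1 : a ≤ n) (h2 : n < a + m)
    (h3 : a ≤ n') (h4 : n' < a + m) : n = n' := by
  rw [ZMod.natCast_eq_natCast_iff] at h
  rcases le_total n n' with hl | hl
  · have := Nat.eq_zero_of_dvd_of_lt ((Nat.modEq_iff_dvd' hl).mp h) (by omega)
    omega
  · have := Nat.eq_zero_of_dvd_of_lt ((Nat.modEq_iff_dvd' hl).mp h.symm) (by omega)
    omega

lemma injOn_window {m a b : ℕ} (hb : b ≤ a + m) :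
    Set.InjOn (fun n : ℕ => (n : ZMod m)) (Finset.Ico a b : Set ℕ) := by
  intro x hx y hy h
  simp only [Finset.coe_Ico, Set.mem_Ico] at hx hy
  exact cast_inj_window (a := a) h hx.1 (by omega) hy.1 (by omega)

lemma bval_arc {m a b : ℕ} (u : ZMod m → ℝ) (hb : b ≤ a + m) :
    bval u (arc m a b) = ∑ n ∈ Finset.Ico a b, u (n : ZMod m) :=
  Finset.sum_image (injOn_window hb)

lemma card_arc {m a b : ℕ} (hb : b ≤ a + m) : (arc m a b).card = b - a := by
  rw [arc, Finset.card_image_of_injOn (injOn_window hb), Nat.card_Ico]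

lemma arc_congr {m a b k : ℕ} (h : (a : ZMod m) = b) : arc m a (a + k) = arc m b (b + k) := by
  ext v
  simp only [mem_arc]
  constructor
  · rintro ⟨n, h1, h2, rfl⟩
    refine ⟨b + (n - a), by omega, by omega, ?_⟩
    rw [Nat.cast_add, ← h, ← Nat.cast_add, Nat.add_sub_cancel' h1]
  · rintro ⟨n, h1, h2, rfl⟩
    refine ⟨a + (n - b), by omega, by omega, ?_⟩
    rw [Nat.cast_add, h, ← Nat.cast_add, Nat.add_sub_cancel' h1]

lemma cycleGraph_adj {m : ℕ} {v w : ZMod m} :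
    (cycleGraph m).Adj v w ↔ v ≠ w ∧ (w = v + 1 ∨ v = w + 1) := by
  simp [cycleGraph]

lemma isBundle_arc {m : ℕ} (hm : 3 ≤ m) (a b : ℕ) : IsBundle (cycleGraph m) (arc m a b) := by
  have : Fact (1 < m) := ⟨by omega⟩
  by_cases hab : a < b
  swap
  · left
    rw [arc, Finset.Ico_eq_empty hab]
    simp
  right
  have ha : (a : ZMod m) ∈ ((arc m a b : Finset (ZMod m)) : Set (ZMod m)) :=
    Finset.mem_coe.mpr (mem_arc.mpr ⟨a, le_rfl, hab, rfl⟩)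
  have reach : ∀ i (h : (((a + i : ℕ) : ZMod m)) ∈ ((arc m a b : Finset (ZMod m)) : Set (ZMod m))),
      a + i < b → ((cycleGraph m).induce ((arc m a b : Finset (ZMod m)) : Set (ZMod m))).Reachable
        ⟨(a : ZMod m), ha⟩ ⟨((a + i : ℕ) : ZMod m), h⟩ := by
    intro i
    induction i with
    | zero => intro h _; exact SimpleGraph.Reachable.refl _
    | succ i ih =>
      intro h hi
      have hmem : (((a + i : ℕ) : ZMod m)) ∈ ((arc m a b : Finset (ZMod m)) : Set (ZMod m)) :=
        Finset.mem_coe.mpr (mem_arc.mpr ⟨a + i, by omega, by omega, rfl⟩)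
      refine (ih hmem (by omega)).trans (SimpleGraph.Adj.reachable ?_)
      rw [SimpleGraph.induce_adj, cycleGraph_adj]
      constructor
      · intro heq
        have := cast_inj_window (a := a + i) heq le_rfl (by omega) (by omega) (by omega)
        omega
      · left; push_cast; ring
  rw [SimpleGraph.connected_iff_exists_forall_reachable]
  refine ⟨⟨(a : ZMod m), ha⟩, ?_⟩
  rintro ⟨v, hv⟩
  obtain ⟨n, h1, h2, rfl⟩ := mem_arc.mp (Finset.mem_coe.mp hv)
  obtain ⟨i, rfl⟩ := Nat.exists_eq_add_of_le h1
  exact reach i hv h2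

lemma exists_arc {m : ℕ} [NeZero m] {S : Finset (ZMod m)} (hS : IsBundle (cycleGraph m) S)
    (hne : S.Nonempty) (hu : S ≠ Finset.univ) :
    ∃ a k : ℕ, a < m ∧ 0 < k ∧ k < m ∧ S = arc m a (a + k) ∧ ((a + k : ℕ) : ZMod m) ∉ S := by
  have hconn : ((cycleGraph m).induce (S : Set (ZMod m))).Connected := by
    rcases hS with h | h
    · exact absurd (Finset.coe_eq_empty.mp h) hne.ne_empty
    · exact h
  obtain ⟨s, hs, hs1⟩ : ∃ s ∈ S, s - 1 ∉ S := by
    by_contra hcon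
    push Not at hcon
    obtain ⟨s0, hs0⟩ := hne
    have all : ∀ n : ℕ, s0 - (n : ZMod m) ∈ S := by
      intro n
      induction n with
      | zero => simpa using hs0
      | succ n ih =>
        have := hcon _ ih
        rwa [sub_sub, ← Nat.cast_succ] at this
    refine hu (Finset.eq_univ_iff_forall.mpr fun v => ?_)
    have := all (s0 - v).val
    rwa [ZMod.natCast_zmod_val, sub_sub_cancel] at this
  obtain ⟨a, ham, rfl⟩ : ∃ a : ℕ, a < m ∧ (a : ZMod m) = s :=
    ⟨s.val, ZMod.val_lt s, ZMod.natCast_zmod_val s⟩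
  have ex : ∃ k : ℕ, ((a + k : ℕ) : ZMod m) ∉ S := by
    refine ⟨m - 1, ?_⟩
    have : ((m - 1 : ℕ) : ZMod m) = -1 := by
      rw [Nat.cast_sub (by omega)]; simp
    rwa [Nat.cast_add, this, ← sub_eq_add_neg]
  have hk := Nat.find_spec ex
  have hmin := fun k (h : k < Nat.find ex) => Nat.find_min ex h
  have hle : Nat.find ex ≤ m - 1 := by
    apply Nat.find_min'
    have : ((m - 1 : ℕ) : ZMod m) = -1 := by
      rw [Nat.cast_sub (by omega)]; simp
    rwa [Nat.cast_add, this, ← sub_eq_add_neg]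
  generalize Nat.find ex = k at hk hmin hle
  have hk0 : 0 < k := by
    rcases Nat.eq_zero_or_pos k with rfl | h
    · exact absurd (by simpa using hs) hk
    · exact h
  refine ⟨a, k, ham, hk0, by omega, ?_, hk⟩
  apply Finset.Subset.antisymm
  · intro v hv
    have hr := hconn.preconnected ⟨(a : ZMod m), hs⟩ ⟨v, hv⟩
    rw [SimpleGraph.reachable_iff_reflTransGen] at hr
    have : ∀ y : (S : Set (ZMod m)), Relation.ReflTransGen
        ((cycleGraph m).induce (S : Set (ZMod m))).Adj ⟨(a : ZMod m), hs⟩ y →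
        (y : ZMod m) ∈ arc m a (a + k) := by
      intro y hy
      induction hy with
      | refl => exact mem_arc.mpr ⟨a, le_rfl, by omega, rfl⟩
      | @tail x y _ hxy ih =>
        obtain ⟨n, h1, h2, h3⟩ := mem_arc.mp ih
        rw [SimpleGraph.induce_adj, cycleGraph_adj] at hxy
        have hyS : (y : ZMod m) ∈ S := y.2
        rcases hxy.2 with h | h
        · refine mem_arc.mpr ⟨n + 1, by omega, ?_, by rw [h, ← h3]; push_cast; ring⟩
          by_contra hlt
          have : n + 1 = a + k := by omega
          apply hk
          rw [← this, Nat.cast_add, h3, Nat.cast_one, ← h]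
          exact hyS
        · have hy' : (y : ZMod m) = x - 1 := by rw [h]; ring
          rcases h1.eq_or_lt with rfl | h1
          · rw [hy', ← h3] at hyS
            exact absurd hyS hs1
          · refine mem_arc.mpr ⟨n - 1, by omega, by omega, ?_⟩
            rw [hy', ← h3, Nat.cast_sub (by omega), Nat.cast_one]
    exact this _ hr
  · intro v hv
    obtain ⟨n, h1, h2, rfl⟩ := mem_arc.mp hv
    have := hmin (n - a) (by omega)
    rw [not_not, Nat.add_sub_cancel' h1] at this
    exact this

/-- A split of the cycle into three nonempty bundles is given by three cuts. -/
lemma exists_cuts {m : ℕ} [NeZero m] {P : Fin 3 → Finset (ZMod m)}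
    (hP : IsSplitOn (cycleGraph m) Finset.univ 3 P) (hne : ∀ i, (P i).Nonempty) :
    ∃ j l : Fin 3, j ≠ 0 ∧ l ≠ 0 ∧ j ≠ l ∧ ∃ p q r : ℕ, p < m ∧ p < q ∧ q < r ∧ r < p + m ∧
      P 0 = arc m p q ∧ P j = arc m q r ∧ P l = arc m r (p + m) := by
  obtain ⟨hb, hd, -, hc⟩ := hP
  have hu : ∀ i, P i ≠ Finset.univ := by
    intro i h
    have other : ∀ i : Fin 3, ∃ j : Fin 3, i ≠ j := by decide
    obtain ⟨j, hj⟩ := other i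
    obtain ⟨v, hv⟩ := hne j
    exact Finset.disjoint_left.mp (hd i j hj) (h ▸ Finset.mem_univ v) hv
  choose a k ham hk0 hkm hPa hend using fun i => exists_arc (hb i) (hne i) (hu i)
  have hcard : ∀ i, (P i).card = k i := by
    intro i
    conv_lhs => rw [hPa i]
    rw [card_arc (by have := hkm i; omega)]; omega
  have hsum : k 0 + k 1 + k 2 = m := by
    have h1 : (Finset.univ.biUnion P).card = ∑ i, (P i).card :=
      Finset.card_biUnion fun i _ j _ hij => hd i j hij
    have h2 : Finset.univ.biUnion P = Finset.univ := by
      ext v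
      obtain ⟨i, hi⟩ := hc v (Finset.mem_univ v)
      simp only [Finset.mem_biUnion, Finset.mem_univ, true_and, iff_true]
      exact ⟨i, hi⟩
    rw [h2, Finset.card_univ, ZMod.card, Fin.sum_univ_three, hcard, hcard, hcard] at h1
    exact h1.symm
  have next : ∀ i, ∃ j, i ≠ j ∧ (a j : ZMod m) = ((a i + k i : ℕ) : ZMod m) := by
    intro i
    obtain ⟨j, hj⟩ := hc ((a i + k i : ℕ) : ZMod m) (Finset.mem_univ _)
    have hij : i ≠ j := by
      rintro rfl
      exact hend i hj
    refine ⟨j, hij, ?_⟩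
    have hj' := hj
    rw [hPa j] at hj'
    obtain ⟨n, h1, h2, h3⟩ := mem_arc.mp hj'
    rcases h1.eq_or_lt with h1 | h1
    · rw [← h3, h1]
    · exfalso
      have m1 : ((n - 1 : ℕ) : ZMod m) ∈ P j := by
        rw [hPa j]; exact mem_arc.mpr ⟨n - 1, by omega, by omega, rfl⟩
      have m2 : ((a i + k i - 1 : ℕ) : ZMod m) ∈ P i := by
        have := hk0 i
        rw [hPa i]; exact mem_arc.mpr ⟨a i + k i - 1, by omega, by omega, rfl⟩
      have : ((n - 1 : ℕ) : ZMod m) = ((a i + k i - 1 : ℕ) : ZMod m) := by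
        have := hk0 i
        rw [Nat.cast_sub (by omega), h3, Nat.cast_sub (by omega)]
      rw [this] at m1
      exact Finset.disjoint_left.mp (hd i j hij) m2 m1
  obtain ⟨j, h0j, hj⟩ := next 0
  obtain ⟨l, hjl, hl⟩ := next j
  have hsum' : ∀ l', l' ≠ 0 → l' ≠ j → k 0 + k j + k l' = m := by
    have : ∀ j l' : Fin 3, 0 ≠ j → l' ≠ 0 → l' ≠ j → k 0 + k j + k l' = k 0 + k 1 + k 2 := by
      intro j l' h1 h2 h3
      fin_cases j <;> fin_cases l' <;> simp_all <;> omega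
    intro l' h1 h2
    rw [this j l' h0j h1 h2, hsum]
  have hl0 : l ≠ 0 := by
    rintro rfl
    have third : ∀ j : Fin 3, ∃ l' : Fin 3, l' ≠ 0 ∧ l' ≠ j := by decide
    obtain ⟨l', h1, h2⟩ := third j
    have hs := hsum' l' h1 h2
    have := hk0 l'; have := hk0 0; have := hk0 j
    have e : ((a 0 : ℕ) : ZMod m) = ((a 0 + (k 0 + k j) : ℕ) : ZMod m) := by
      rw [hl, Nat.cast_add, hj]; push_cast; ring
    have := cast_inj_window (a := a 0) e le_rfl (by omega) (by omega) (by omega)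
    omega
  have hs := hsum' l hl0 hjl.symm
  have := hk0 0; have := hk0 j; have := hk0 l
  refine ⟨j, l, h0j.symm, hl0, hjl, a 0, a 0 + k 0, a 0 + k 0 + k j, ham 0, by omega, by omega,
    by omega, hPa 0, ?_, ?_⟩
  · rw [hPa j]; exact arc_congr hj
  · rw [hPa l, show a 0 + m = a 0 + k 0 + k j + k l by omega]
    apply arc_congr
    rw [hl, Nat.cast_add, hj]; push_cast; ring

/-- Three cuts give a split, with bundles labelled in any order. -/
lemma split_of_cuts {m : ℕ} [NeZero m] (hm : 3 ≤ m) {i j k : Fin 3} (hij : i ≠ j) (hjk : j ≠ k) (hik : i ≠ k)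
    {p q r : ℕ} (hpq : p ≤ q) (hqr : q ≤ r) (hr : r ≤ p + m) :
    ∃ P : Fin 3 → Finset (ZMod m), IsSplitOn (cycleGraph m) Finset.univ 3 P ∧
      P i = arc m p q ∧ P j = arc m q r ∧ P k = arc m r (p + m) := by
  have hall : ∀ i j k : Fin 3, i ≠ j → j ≠ k → i ≠ k → ∀ t, t = i ∨ t = j ∨ t = k := by decide
  obtain ⟨f, hfi, hfj, hfk⟩ : ∃ f : Fin 3 → ℕ × ℕ, f i = (p, q) ∧ f j = (q, r) ∧ f k = (r, p + m) :=
    ⟨fun t => if t = i then (p, q) else if t = j then (q, r) else (r, p + m), by simp,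
      by simp [hij.symm], by simp [hik.symm, hjk.symm]⟩
  refine ⟨fun t => arc m (f t).1 (f t).2, ⟨fun t => isBundle_arc hm _ _, ?_, fun t => Finset.subset_univ _, ?_⟩,
    by simp [hfi], by simp [hfj], by simp [hfk]⟩
  · intro s t hst
    rw [Finset.disjoint_left]
    intro v hv hv'
    obtain ⟨n, h1, h2, rfl⟩ := mem_arc.mp hv
    obtain ⟨n', h1', h2', h3⟩ := mem_arc.mp hv'
    have key : n' = n → False := by
      rintro rfl
      rcases hall i j k hij hjk hik s with rfl | rfl | rfl <;>
      rcases hall _ _ _ hij hjk hik t with rfl | rfl | rfl <;>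
      simp only [hfi, hfj, hfk, ne_eq, not_true] at h1 h2 h1' h2' hst <;> omega
    have bd : ∀ t, p ≤ (f t).1 ∧ (f t).2 ≤ p + m := by
      intro t
      rcases hall i j k hij hjk hik t with rfl | rfl | rfl <;> simp only [hfi, hfj, hfk] <;> omega
    have := bd s; have := bd t
    exact key (cast_inj_window (a := p) h3 (by omega) (by omega) (by omega) (by omega))
  · intro v _
    have hlt := ZMod.val_lt (v - (p : ZMod m))
    have hv : ((p + (v - (p : ZMod m)).val : ℕ) : ZMod m) = v := by
      rw [Nat.cast_add, ZMod.natCast_zmod_val]; ring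
    generalize (v - (p : ZMod m)).val = n at hlt hv
    by_cases h1 : p + n < q
    · exact ⟨i, by simp only [hfi]; exact mem_arc.mpr ⟨p + n, by omega, h1, hv⟩⟩
    by_cases h2 : p + n < r
    · exact ⟨j, by simp only [hfj]; exact mem_arc.mpr ⟨p + n, by omega, h2, hv⟩⟩
    · exact ⟨k, by simp only [hfk]; exact mem_arc.mpr ⟨p + n, by omega, by omega, hv⟩⟩

/-- Prefix sums of a utility along the cycle. -/
def cumVal {m : ℕ} (u : ZMod m → ℝ) (n : ℕ) : ℝ := ∑ i ∈ Finset.range n, u (i : ZMod m)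

lemma cumVal_mono {m : ℕ} {u : ZMod m → ℝ} (hu : ∀ v, 0 ≤ u v) : Monotone (cumVal u) :=
  monotone_nat_of_le_succ fun n => by
    rw [cumVal, cumVal, Finset.sum_range_succ]; linarith [hu n]

lemma cumVal_add {m : ℕ} (u : ZMod m → ℝ) (n : ℕ) :
    cumVal u (n + m) = cumVal u n + cumVal u m := by
  unfold cumVal
  rw [add_comm n m, Finset.sum_range_add, add_comm]
  simp

lemma bval_arc_eq {m a b : ℕ} (u : ZMod m → ℝ) (hab : a ≤ b) (hb : b ≤ a + m) :
    bval u (arc m a b) = cumVal u b - cumVal u a := by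
  rw [bval_arc u hb, Finset.sum_Ico_eq_sub _ hab]; rfl

lemma exists_split_mms {m : ℕ} [NeZero m] (hm : 3 ≤ m) (u : ZMod m → ℝ) :
    ∃ P : Fin 3 → Finset (ZMod m), IsSplitOn (cycleGraph m) Finset.univ 3 P ∧
      ∀ i, mms (cycleGraph m) 3 u ≤ bval u (P i) := by
  classical
  obtain ⟨P0, hP0, -⟩ := split_of_cuts (m := m) hm (i := 0) (j := 1) (k := 2) (by decide) (by decide)
    (by decide) (p := 0) (q := 1) (r := 2) (by omega) (by omega) (by omega)
  let f : (Fin 3 → Finset (ZMod m)) → ℝ := fun P => Finset.univ.inf' ⟨0, Finset.mem_univ 0⟩ fun i => bval u (P i)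
  obtain ⟨P, hP, hmax⟩ := Set.exists_max_image
    {P : Fin 3 → Finset (ZMod m) | IsSplitOn (cycleGraph m) Finset.univ 3 P} f (Set.toFinite _)
    ⟨P0, hP0⟩
  refine ⟨P, hP, fun i => ?_⟩
  have h1 : f P ≤ bval u (P i) := Finset.inf'_le _ (Finset.mem_univ i)
  refine le_trans ?_ h1
  refine csSup_le ⟨f P, P, hP, fun j => Finset.inf'_le _ (Finset.mem_univ j)⟩ ?_
  rintro q ⟨Q, hQ, hq⟩
  exact le_trans (Finset.le_inf' _ _ fun j _ => hq j) (hmax Q hQ)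

lemma le_mms {m : ℕ} [NeZero m] {u : ZMod m → ℝ} (hu : ∀ v, 0 ≤ u v)
    {P : Fin 3 → Finset (ZMod m)} (hP : IsSplitOn (cycleGraph m) Finset.univ 3 P) {q : ℝ}
    (hq : ∀ i, q ≤ bval u (P i)) : q ≤ mms (cycleGraph m) 3 u := by
  refine le_csSup ⟨∑ v, u v, ?_⟩ ⟨P, hP, hq⟩
  rintro q' ⟨Q, -, h⟩
  exact (h 0).trans (Finset.sum_le_sum_of_subset_of_nonneg (Finset.subset_univ _) fun v _ _ => hu v)

lemma exists_cut_sequence {m : ℕ} {F : ℕ → ℝ} (hT : ∃ T, ∀ n, F (n + m) = F n + T)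
    {p q r : ℕ} (hpm : p < m) (hpq : p < q) (hqr : q < r) (hr : r < p + m) {μ : ℝ}
    (h1 : μ ≤ F q - F p) (h2 : μ ≤ F r - F q) (h3 : μ ≤ F (p + m) - F r) :
    ∃ e : ℕ → ℕ, Monotone e ∧ (∀ n, e (n + 3) = e n + m) ∧ e 0 < m ∧
      ∀ n, μ ≤ F (e (n + 1)) - F (e n) := by
  obtain ⟨T, hT⟩ := hT
  have hT' : ∀ t n, F (n + m * t) = F n + t * T := by
    intro t
    induction t with
    | zero => intro n; simp
    | succ t ih =>
      intro n
      rw [show n + m * (t + 1) = n + m * t + m by ring, hT, ih]; push_cast; ring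
  have cases3 : ∀ n : ℕ, ∃ t, n = 3 * t ∨ n = 3 * t + 1 ∨ n = 3 * t + 2 := fun n =>
    ⟨n / 3, by omega⟩
  refine ⟨merge3 (fun t => p + m * t) (fun t => q + m * t) (fun t => r + m * t), ?_, ?_, ?_, ?_⟩
  · refine monotone_nat_of_le_succ fun n => ?_
    obtain ⟨t, rfl | rfl | rfl⟩ := cases3 n
    · rw [merge3_zero, merge3_one]; omega
    · rw [merge3_one, show 3 * t + 1 + 1 = 3 * t + 2 by ring, merge3_two]; omega
    · rw [merge3_two, show 3 * t + 2 + 1 = 3 * (t + 1) by ring, merge3_zero, mul_add]; omega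
  · intro n
    obtain ⟨t, rfl | rfl | rfl⟩ := cases3 n
    · rw [show 3 * t + 3 = 3 * (t + 1) by ring, merge3_zero, merge3_zero]; ring
    · rw [show 3 * t + 1 + 3 = 3 * (t + 1) + 1 by ring, merge3_one, merge3_one]; ring
    · rw [show 3 * t + 2 + 3 = 3 * (t + 1) + 2 by ring, merge3_two, merge3_two]; ring
  · simpa [merge3] using hpm
  · intro n
    obtain ⟨t, rfl | rfl | rfl⟩ := cases3 n
    · rw [merge3_zero, merge3_one, hT', hT']; linarith
    · rw [merge3_one, show 3 * t + 1 + 1 = 3 * t + 2 by ring, merge3_two, hT', hT']; linarith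
    · rw [merge3_two, show 3 * t + 2 + 1 = 3 * (t + 1) by ring, merge3_zero,
        show p + m * (t + 1) = p + m + m * t by ring, hT', hT']
      linarith

lemma exists_agent_cuts {m : ℕ} [NeZero m] (hm : 3 ≤ m) {u : ZMod m → ℝ} (hu : ∀ v, 0 ≤ u v) :
    ∃ e : ℕ → ℕ, Monotone e ∧ (∀ n, e (n + 3) = e n + m) ∧ e 0 < m ∧
      ∀ n, max (mms (cycleGraph m) 3 u) 0 ≤ cumVal u (e (n + 1)) - cumVal u (e n) := by
  have hT : ∃ T, ∀ n, cumVal u (n + m) = cumVal u n + T := ⟨_, cumVal_add u⟩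
  have hmono := cumVal_mono hu
  rcases le_or_gt (mms (cycleGraph m) 3 u) 0 with h0 | h0
  · rw [max_eq_right h0]
    exact exists_cut_sequence hT (p := 0) (q := 1) (r := 2) (by omega) (by omega) (by omega)
      (by omega) (sub_nonneg.mpr (hmono (by omega))) (sub_nonneg.mpr (hmono (by omega)))
      (sub_nonneg.mpr (hmono (by omega)))
  · rw [max_eq_left h0.le]
    obtain ⟨P, hP, hv⟩ := exists_split_mms hm u
    have hne : ∀ i, (P i).Nonempty := by
      intro i
      rw [Finset.nonempty_iff_ne_empty]
      intro he
      have := hv i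
      rw [he] at this
      simp only [bval, Finset.sum_empty] at this
      linarith
    obtain ⟨j, l, -, -, -, p, q, r, hpm, hpq, hqr, hr, e0, ej, el⟩ := exists_cuts hP hne
    have v0 := hv 0
    have vj := hv j
    have vl := hv l
    rw [e0, bval_arc_eq u (by omega) (by omega)] at v0
    rw [ej, bval_arc_eq u (by omega) (by omega)] at vj
    rw [el, bval_arc_eq u (by omega) (by omega)] at vl
    exact exists_cut_sequence hT hpm hpq hqr hr v0 vj vl

theorem exists_allocation (m : ℕ) [NeZero m] (hm : 3 ≤ m) (us : Fin 3 → ZMod m → ℝ)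
    (hu : ∀ i v, 0 ≤ us i v) :
    ∃ P : Fin 3 → Finset (ZMod m), IsSplitOn (cycleGraph m) Finset.univ 3 P ∧
      ∀ i, 5 / 6 * mms (cycleGraph m) 3 (us i) ≤ bval (us i) (P i) := by
  choose e he hem he0 hv using fun i => exists_agent_cuts hm (hu i)
  obtain ⟨i, j, k, hij, hjk, hik, p, q, r, hpq, hqr, hr, h1, h2, h3⟩ :=
    lineOk (F := fun i => cumVal (us i)) (μ := fun i => max (mms (cycleGraph m) 3 (us i)) 0)
      (fun i => cumVal_mono (hu i)) (fun i => cumVal_add (us i))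
      (fun i => le_max_right _ _) e he hem he0 hv
  obtain ⟨P, hP, ei, ej, ek⟩ := split_of_cuts hm hij hjk hik hpq hqr hr
  refine ⟨P, hP, fun t => ?_⟩
  have hall : ∀ i j k : Fin 3, i ≠ j → j ≠ k → i ≠ k → ∀ t, t = i ∨ t = j ∨ t = k := by decide
  have hmax := le_max_left (mms (cycleGraph m) 3 (us t)) 0
  refine le_trans (mul_le_mul_of_nonneg_left hmax (by norm_num)) ?_
  rcases hall i j k hij hjk hik t with rfl | rfl | rfl
  · rw [ei, bval_arc_eq _ hpq (by omega)]; exact h1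
  · rw [ej, bval_arc_eq _ hqr (by omega)]; exact h2
  · rw [ek, bval_arc_eq _ hr (by omega)]; exact h3

/-! ### The tight example -/

/-- Prefix sums of a list of nine naturals, repeated periodically. -/
def pre9 (L : List ℕ) : ℕ → ℕ
  | 0 => 0
  | n + 1 => pre9 L n + L.getD (n % 9) 0

lemma cumVal_eq_pre9 {u : ZMod 9 → ℝ} (L : List ℕ)
    (h : ∀ t : ZMod 9, u t = ((L.getD t.val 0 : ℕ) : ℝ)) (n : ℕ) :
    cumVal u n = (pre9 L n : ℝ) := by
  induction n with
  | zero => simp [cumVal, pre9]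
  | succ n ih =>
    have : cumVal u (n + 1) = cumVal u n + u n := Finset.sum_range_succ _ _
    rw [this, ih, h, ZMod.val_natCast, pre9]; push_cast; ring

lemma le_mms_nine {u : ZMod 9 → ℝ} (L : List ℕ)
    (h : ∀ t : ZMod 9, u t = ((L.getD t.val 0 : ℕ) : ℝ)) {p c : ℕ}
    (h1 : pre9 L p + c ≤ pre9 L (p + 3)) (h2 : pre9 L (p + 3) + c ≤ pre9 L (p + 6))
    (h3 : pre9 L (p + 6) + c ≤ pre9 L (p + 9)) : (c : ℝ) ≤ mms (cycleGraph 9) 3 u := by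
  obtain ⟨P, hP, e0, e1, e2⟩ := split_of_cuts (m := 9) (by norm_num) (i := 0) (j := 1) (k := 2)
    (by decide) (by decide) (by decide) (p := p) (q := p + 3) (r := p + 6) (by omega) (by omega)
    (by omega)
  refine le_mms (fun v => by rw [h]; positivity) hP fun i => ?_
  have h1' : (pre9 L p : ℝ) + c ≤ pre9 L (p + 3) := by exact_mod_cast h1
  have h2' : (pre9 L (p + 3) : ℝ) + c ≤ pre9 L (p + 6) := by exact_mod_cast h2
  have h3' : (pre9 L (p + 6) : ℝ) + c ≤ pre9 L (p + 9) := by exact_mod_cast h3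
  fin_cases i
  · show (c : ℝ) ≤ bval u (P 0)
    rw [e0, bval_arc_eq _ (by omega) (by omega), cumVal_eq_pre9 L h, cumVal_eq_pre9 L h]
    linarith
  · show (c : ℝ) ≤ bval u (P 1)
    rw [e1, bval_arc_eq _ (by omega) (by omega), cumVal_eq_pre9 L h, cumVal_eq_pre9 L h]
    linarith
  · show (c : ℝ) ≤ bval u (P 2)
    rw [e2, bval_arc_eq _ (by omega) (by omega), cumVal_eq_pre9 L h, cumVal_eq_pre9 L h]
    linarith

/-- The utilities of the tight example. -/
def exL : Fin 3 → List ℕ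
  | 0 => [0, 3, 1, 3, 1, 3, 0, 2, 2]
  | 1 => [2, 2, 0, 3, 1, 3, 1, 3, 0]
  | 2 => [1, 3, 2, 3, 0, 3, 2, 3, 1]

/-- The largest value below the demanded one in the tight example. -/
def exB : Fin 3 → ℕ
  | 0 => 4
  | 1 => 4
  | 2 => 5

lemma tight_check_aux : ∀ p < 9, ∀ a < 9, ∀ b < 9,
    (pre9 (exL 0) (p + a) ≤ pre9 (exL 0) p + exB 0 ∨
    pre9 (exL 1) (p + a + b) ≤ pre9 (exL 1) (p + a) + exB 1 ∨
    pre9 (exL 2) (p + 9) ≤ pre9 (exL 2) (p + a + b) + exB 2) ∧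
    (pre9 (exL 0) (p + a) ≤ pre9 (exL 0) p + exB 0 ∨
    pre9 (exL 2) (p + a + b) ≤ pre9 (exL 2) (p + a) + exB 2 ∨
    pre9 (exL 1) (p + 9) ≤ pre9 (exL 1) (p + a + b) + exB 1) := by
  decide +kernel

lemma tight_check {p a b : ℕ} (hp : p < 9) (ha : a < 9) (hb : b < 9) (j l : Fin 3) (hj : j ≠ 0)
    (hl : l ≠ 0) (hjl : j ≠ l) :
    pre9 (exL 0) (p + a) ≤ pre9 (exL 0) p + exB 0 ∨
    pre9 (exL j) (p + a + b) ≤ pre9 (exL j) (p + a) + exB j ∨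
    pre9 (exL l) (p + 9) ≤ pre9 (exL l) (p + a + b) + exB l := by
  have h := tight_check_aux p hp a ha b hb
  have hcase : ∀ j l : Fin 3, j ≠ 0 → l ≠ 0 → j ≠ l → (j = 1 ∧ l = 2) ∨ (j = 2 ∧ l = 1) := by
    decide
  rcases hcase j l hj hl hjl with ⟨rfl, rfl⟩ | ⟨rfl, rfl⟩
  · exact h.1
  · exact h.2

theorem tight_example (us : Fin 3 → ZMod 9 → ℝ)
    (h : ∀ i (t : ZMod 9), us i t = (((exL i).getD t.val 0 : ℕ) : ℝ)) (c : ℝ) (hc : 5 / 6 < c) :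
    ¬ ∃ P : Fin 3 → Finset (ZMod 9), IsSplitOn (cycleGraph 9) Finset.univ 3 P ∧
      ∀ i, c * mms (cycleGraph 9) 3 (us i) ≤ bval (us i) (P i) := by
  rintro ⟨P, hP, hv⟩
  have m0 := le_mms_nine (exL 0) (h 0) (p := 2) (c := 5) (by decide) (by decide) (by decide)
  have m1 := le_mms_nine (exL 1) (h 1) (p := 1) (c := 5) (by decide) (by decide) (by decide)
  have m2 := le_mms_nine (exL 2) (h 2) (p := 0) (c := 6) (by decide) (by decide) (by decide)
  have big : ∀ i, (exB i : ℝ) < bval (us i) (P i) := by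
    intro i
    refine lt_of_lt_of_le ?_ (hv i)
    fin_cases i
    · show ((4 : ℕ) : ℝ) < c * mms (cycleGraph 9) 3 (us 0)
      push_cast at m0 ⊢; nlinarith
    · show ((4 : ℕ) : ℝ) < c * mms (cycleGraph 9) 3 (us 1)
      push_cast at m1 ⊢; nlinarith
    · show ((5 : ℕ) : ℝ) < c * mms (cycleGraph 9) 3 (us 2)
      push_cast at m2 ⊢; nlinarith
  have hne : ∀ i, (P i).Nonempty := by
    intro i
    rw [Finset.nonempty_iff_ne_empty]
    intro he
    have := big i
    rw [he] at this
    simp only [bval, Finset.sum_empty] at this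
    exact absurd this (not_lt.mpr (Nat.cast_nonneg _))
  obtain ⟨j, l, hj, hl, hjl, p, q, r, hpm, hpq, hqr, hr, e0, ej, el⟩ := exists_cuts hP hne
  obtain ⟨a, rfl⟩ := Nat.exists_eq_add_of_le hpq.le
  obtain ⟨b, rfl⟩ := Nat.exists_eq_add_of_le hqr.le
  have b0 := big 0
  have bj := big j
  have bl := big l
  rw [e0, bval_arc_eq _ (by omega) (by omega), cumVal_eq_pre9 _ (h _),
    cumVal_eq_pre9 _ (h _), lt_sub_iff_add_lt'] at b0
  rw [ej, bval_arc_eq _ (by omega) (by omega), cumVal_eq_pre9 _ (h _),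
    cumVal_eq_pre9 _ (h _), lt_sub_iff_add_lt'] at bj
  rw [el, bval_arc_eq _ (by omega) (by omega), cumVal_eq_pre9 _ (h _),
    cumVal_eq_pre9 _ (h _), lt_sub_iff_add_lt'] at bl
  norm_cast at b0 bj bl
  rcases tight_check hpm (a := a) (by omega) (b := b) (by omega) j l hj hl hjl with t | t | t <;> omega

/-- for three agents on a cycle a `5/6`-sufficient allocation always
exists, and `5/6` is optimal: on the 9-cycle with the given utilities no
`c`-sufficient allocation exists for any `c > 5/6`. -/
theorem stmt13 :
    (∀ (m : ℕ) [NeZero m], 3 ≤ m →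
      ∀ us : Fin 3 → ZMod m → ℝ, (∀ i v, 0 ≤ us i v) →
        ∃ P : Fin 3 → Finset (ZMod m), IsSplitOn (cycleGraph m) Finset.univ 3 P ∧
          ∀ i, 5 / 6 * mms (cycleGraph m) 3 (us i) ≤ bval (us i) (P i)) ∧
    (∀ us : Fin 3 → ZMod 9 → ℝ,
      (∀ t : ZMod 9, us 0 t = ([0, 3, 1, 3, 1, 3, 0, 2, 2] : List ℝ).getD t.val 0) →
      (∀ t : ZMod 9, us 1 t = ([2, 2, 0, 3, 1, 3, 1, 3, 0] : List ℝ).getD t.val 0) →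
      (∀ t : ZMod 9, us 2 t = ([1, 3, 2, 3, 0, 3, 2, 3, 1] : List ℝ).getD t.val 0) →
      ∀ c : ℝ, 5 / 6 < c →
        ¬ ∃ P : Fin 3 → Finset (ZMod 9), IsSplitOn (cycleGraph 9) Finset.univ 3 P ∧
            ∀ i, c * mms (cycleGraph 9) 3 (us i) ≤ bval (us i) (P i)) := by
  refine ⟨fun m _ hm us hu => exists_allocation m hm us hu, ?_⟩
  intro us h0 h1 h2 c hc
  refine tight_example us (fun i t => ?_) c hc
  have key : ∀ (L : List ℕ) (n : ℕ), (L.map (fun a : ℕ => (a : ℝ))).getD n 0 = ((L.getD n 0 : ℕ) : ℝ) := by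
    intro L n
    have := List.getD_map (l := L) (d := 0) (n := n) (fun a : ℕ => (a : ℝ))
    simpa using this
  rw [← key]
  fin_cases i
  · show us 0 t = _
    rw [h0]; simp [exL]
  · show us 1 t = _
    rw [h1]; simp [exL]
  · show us 2 t = _
    rw [h2]; simp [exL]
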